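/- arXiv:1706.09993 — 2 statements merged into one kernel-verified Lean document; each statement's English description precedes it below -/
import Mathlib

section
/- Let a be a random vector distributed uniformly on the unit sphere S^{n−1} ⊂ ℝⁿ (n ≥ 3), and let x, z ∈ ℝⁿ be nonzero vectors with ⟨x, z⟩ > 0 making an angle θ with each other. Then the symmetric matrix M := E[aaᵀ·1_{W_{x,z}}(a)] has largest eigenvalue λ_max(M) = (θ + sin θ)/(nπ). -/
open MeasureTheory ProbabilityTheory
open scoped RealInnerProductSpace ENNReal BigOperators

noncomputable section

/-- `ℝⁿ` with the Euclidean structure. -/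
abbrev Euc (n : ℕ) := EuclideanSpace ℝ (Fin n)

/-- The sign function used in the paper: `sgn t = 1` if `t ≥ 0` and `-1` otherwise. -/
def sgn (t : ℝ) : ℝ := if 0 ≤ t then 1 else -1

/-- One (generalized) Kaczmarz step for phase retrieval with signal `x`,
measurement vector `a`, applied to the current iterate `z`:
`Pz = z + (sign(⟨a,z⟩)·|⟨a,x⟩| − ⟨a,z⟩) a`. -/
def kacStep {n : ℕ} (x a z : Euc n) : Euc n :=
  z + (sgn ⟪a, z⟫ * |⟪a, x⟫| - ⟪a, z⟫) • a

/-- The randomized Kaczmarz iterates `X_k = P_k ⋯ P_1 x₀`, where step `k+1`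
uses the measurement vector `a k`. -/
def kacIter {n : ℕ} (x : Euc n) (a : ℕ → Euc n) (x0 : Euc n) : ℕ → Euc n
  | 0 => x0
  | k + 1 => kacStep x (a k) (kacIter x a x0 k)

/-- The spherical wedge `W_{x,z}`: points of the unit sphere where the signs of
`⟨v,x⟩` and `⟨v,z⟩` disagree. -/
def wedge {n : ℕ} (x z : Euc n) : Set (Euc n) :=
  {v | v ∈ Metric.sphere (0 : Euc n) 1 ∧ sgn ⟪v, x⟫ ≠ sgn ⟪v, z⟫}

/-- The matrix `E_{a∼μ}[a aᵀ]`. -/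
def covMat {n : ℕ} (μ : Measure (Euc n)) : Matrix (Fin n) (Fin n) ℝ :=
  Matrix.of fun i j => ∫ a, a i * a j ∂μ

/-- The matrix `E_{a∼μ}[a aᵀ 1_W(a)]`. -/
def covMatOn {n : ℕ} (μ : Measure (Euc n)) (W : Set (Euc n)) : Matrix (Fin n) (Fin n) ℝ :=
  Matrix.of fun i j => ∫ a in W, a i * a j ∂μ

/-- The quadratic form `vᵀ M v` of a matrix. -/
def quadForm {n : ℕ} (M : Matrix (Fin n) (Fin n) ℝ) (v : Euc n) : ℝ :=
  ∑ i, ∑ j, v i * M i j * v j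

/-- The smallest eigenvalue of a symmetric matrix, via the Rayleigh quotient
characterization `λ_min(M) = inf_{‖v‖=1} vᵀMv`. -/
def lamMin {n : ℕ} (M : Matrix (Fin n) (Fin n) ℝ) : ℝ :=
  ⨅ v : {v : Euc n // ‖v‖ = 1}, quadForm M (v : Euc n)

/-- The largest eigenvalue of a symmetric matrix, via the Rayleigh quotient
characterization `λ_max(M) = sup_{‖v‖=1} vᵀMv`. -/
def lamMax {n : ℕ} (M : Matrix (Fin n) (Fin n) ℝ) : ℝ :=
  ⨆ v : {v : Euc n // ‖v‖ = 1}, quadForm M (v : Euc n)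

/-- The uniform probability measure on the unit sphere `S^{n-1} ⊂ ℝⁿ`:
the normalized `(n-1)`-dimensional Hausdorff measure on the sphere. -/
def sphereUniform (n : ℕ) : Measure (Euc n) :=
  (μH[(n : ℝ) - 1] (Metric.sphere (0 : Euc n) 1))⁻¹ •
    (μH[(n : ℝ) - 1]).restrict (Metric.sphere (0 : Euc n) 1)

/-- The `ACW(θ, α)` (anti-concentration on wedges) condition: for every wedge `W`
of angle less than `θ`, `λ_min(E[aaᵀ] − 4 E[aaᵀ 1_W(a)]) ≥ α/n`. -/
def ACW {n : ℕ} (μ : Measure (Euc n)) (θ α : ℝ) : Prop :=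
  ∀ x z : Euc n, x ≠ 0 → z ≠ 0 → InnerProductGeometry.angle x z < θ →
    lamMin (covMat μ - (4 : ℝ) • covMatOn μ (wedge x z)) ≥ α / n

/-- The hitting time `τ = min{k : X_k ∉ B}` (equal to `⊤ = ∞` if the trajectory
never leaves `B`). -/
def hitTime {n : ℕ} (B : Set (Euc n)) (X : ℕ → Euc n) : ℕ∞ :=
  ⨅ j ∈ {j : ℕ | X j ∉ B}, (j : ℕ∞)

/-- The stopped iterate `X_{τ ∧ k}` where `τ = hitTime B`. -/
def stoppedIter {n : ℕ} (x : Euc n) (a : ℕ → Euc n) (x0 : Euc n) (B : Set (Euc n)) (k : ℕ) :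
    Euc n :=
  kacIter x a x0 (min (hitTime B (kacIter x a x0)) (k : ℕ∞)).toNat

/-- The filtration `(F_k)` where `F_k = σ(a_0, …, a_{k-1})` is generated by the
first `k` measurement vectors. -/
def measFiltration {Ω : Type*} {mΩ : MeasurableSpace Ω} {n : ℕ}
    (A : ℕ → Ω → Euc n) (hA : ∀ i, Measurable (A i)) : Filtration ℕ mΩ where
  seq k := ⨆ j ∈ Set.Iio k, MeasurableSpace.comap (A j) inferInstance
  mono' _ _ hij := biSup_mono fun _ ha => lt_of_lt_of_le ha hij
  le' _ := iSup₂_le fun j _ => measurable_iff_comap_le.mp (hA j)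

/-- The set `S_τ` of `{0,1}`-vectors of length `m` with at most `τ·m` ones. -/
def selVecs (m : ℕ) (τ : ℝ) : Set (Fin m → ℝ) :=
  {s | (∀ i, s i = 0 ∨ s i = 1) ∧ ∑ i, s i ≤ τ * m}

/-- The Euclidean unit ball `B₂ⁿ ⊂ ℝⁿ`. -/
def unitBall (n : ℕ) : Set (Euc n) :=
  {v | ‖v‖ ≤ 1}

/-- A process `(Y_t)_{t ∈ T}` has *mixed tail increments* with respect to a pair of
metrics `(d₁, d₂)`: there are constants `c, C > 0` with
`P(|Y_s − Y_t| ≥ c(√u d₂(s,t) + u d₁(s,t))) ≤ C e^{−u}` for all `s,t,u`. -/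
def HasMixedTailIncrements {Ω T : Type*} [MeasurableSpace Ω] (P : Measure Ω)
    (Y : T → Ω → ℝ) (d₁ d₂ : T → T → ℝ) : Prop :=
  ∃ c C : ℝ, 0 < c ∧ 0 < C ∧ ∀ s t : T, ∀ u : ℝ, 0 < u →
    P {ω | c * (Real.sqrt u * d₂ s t + u * d₁ s t) ≤ |Y s ω - Y t ω|} ≤
      ENNReal.ofReal (C * Real.exp (-u))

/-- An admissible sequence of subsets: `|T₀| = 1` and `|T_k| ≤ 2^(2^k)` for `k ≥ 1`
(the sets are taken nonempty so that distances to them are meaningful). -/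
def Admissible {T : Type*} (Ts : ℕ → Finset T) : Prop :=
  (Ts 0).card = 1 ∧ (∀ k, 1 ≤ k → (Ts k).card ≤ 2 ^ 2 ^ k) ∧ ∀ k, (Ts k).Nonempty

/-- The distance from a point to a finite set, for an abstract metric `d`. -/
def distToFinset {T : Type*} (d : T → T → ℝ) (t : T) (S : Finset T) : ℝ :=
  sInf ((fun u => d t u) '' (S : Set T))

/-- Talagrand's `γ_α` functional of a metric space `(T, d)` (here `T` is a type and
`d` an abstract metric on it): `γ_α(T,d) = inf_{(T_k)} sup_t Σ_k 2^{k/α} d(t, T_k)`,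
the infimum being over admissible sequences. -/
def gammaFunctional {T : Type*} (α : ℝ) (d : T → T → ℝ) : ℝ :=
  ⨅ Ts : {Ts : ℕ → Finset T // Admissible Ts},
    ⨆ t : T, ∑' k : ℕ, (2 : ℝ) ^ ((k : ℝ) / α) * distToFinset d t ((Ts : ℕ → Finset T) k)

end

namespace WedgeProof
open Set Metric Module

theorem finrank_orth {n : ℕ} (hn : 1 ≤ n) (v : Euc n) (hv : ‖v‖ = 1) :
    ((finrank ℝ (Submodule.span ℝ {v})ᗮ : ℕ) : ℝ) = (n : ℝ) - 1 := by
  obtain ⟨m, rfl⟩ : ∃ m, n = m + 1 := ⟨n - 1, by omega⟩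
  have : Fact (finrank ℝ (Euc (m + 1)) = m + 1) := ⟨by simp⟩
  have hv0 : v ≠ 0 := by
    rintro rfl
    simp at hv
  rw [Submodule.finrank_orthogonal_span_singleton (n := m) hv0]
  push_cast
  ring

theorem hemi_lt_top {n : ℕ} (hn : 1 ≤ n) (v : Euc n) (hv : ‖v‖ = 1) :
    μH[(n : ℝ) - 1] (sphere (0 : Euc n) 1 ∩ {a | ⟪v, a⟫ ≤ 0}) < ⊤ := by
  have hfr := finrank_orth hn v hv
  set K := sphere (0 : Euc n) 1 ∩ {a | ⟪v, a⟫ ≤ 0} with hK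
  have hKc : IsCompact K := (isCompact_sphere _ _).inter_right
    (isClosed_le (by fun_prop) continuous_const)
  have hcont : ContinuousOn (stereoToFun v) K := by
    refine (continuousOn_stereoToFun (v := v)).mono ?_
    rintro a ⟨-, ha⟩
    simp only [mem_ofPred_eq, innerSL_apply_apply] at ha ⊢
    intro h
    linarith
  obtain ⟨R, hR⟩ := (hKc.image_of_continuousOn hcont).isBounded.subset_closedBall 0
  have hcd : ContDiff ℝ 1 (fun w : (Submodule.span ℝ {v})ᗮ => stereoInvFunAux v (w : Euc n)) :=
    (contDiff_stereoInvFunAux (m := 1)).comp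
      ((Submodule.span ℝ {v})ᗮ.subtypeL.contDiff)
  obtain ⟨C, hC⟩ := (hcd.contDiffOn (s := closedBall 0 R)).exists_lipschitzOnWith one_ne_zero
    (convex_closedBall 0 R) (isCompact_closedBall 0 R)
  have hsub : K ⊆ (fun w : (Submodule.span ℝ {v})ᗮ => stereoInvFunAux v (w : Euc n)) ''
      closedBall 0 R := by
    intro a ha
    refine ⟨stereoToFun v a, hR ⟨a, ha, rfl⟩, ?_⟩
    have hne : a ≠ v := by
      rintro rfl
      have := ha.2
      simp only [mem_ofPred_eq, real_inner_self_eq_norm_sq, hv] at this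
      norm_num at this
    have := stereo_left_inv hv (x := ⟨a, ha.1⟩) hne
    exact congrArg Subtype.val this
  have hd : (0 : ℝ) ≤ (n : ℝ) - 1 := by
    have : (1 : ℝ) ≤ n := by exact_mod_cast hn
    linarith
  refine (measure_mono hsub).trans_lt ((hC.hausdorffMeasure_image_le hd).trans_lt ?_)
  refine ENNReal.mul_lt_top (ENNReal.rpow_lt_top_of_nonneg hd (by simp)) ?_
  rw [← hfr]
  exact (isCompact_closedBall _ _).measure_lt_top

theorem sphere_lt_top {n : ℕ} (hn : 1 ≤ n) :
    μH[(n : ℝ) - 1] (sphere (0 : Euc n) 1) < ⊤ := by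
  set v : Euc n := EuclideanSpace.single ⟨0, hn⟩ 1 with hvd
  have hv : ‖v‖ = 1 := by simp [hvd]
  have h1 := hemi_lt_top hn v hv
  have h2 := hemi_lt_top hn (-v) (by simpa using hv)
  refine (measure_mono ?_).trans_lt (measure_union_lt_top h1 h2)
  intro a ha
  rcases le_total ⟪v, a⟫ 0 with h | h
  · exact Or.inl ⟨ha, h⟩
  · refine Or.inr ⟨ha, ?_⟩
    simpa [inner_neg_left] using h

theorem sphere_ne_zero {n : ℕ} (hn : 1 ≤ n) :
    μH[(n : ℝ) - 1] (sphere (0 : Euc n) 1) ≠ 0 := by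
  set v : Euc n := EuclideanSpace.single ⟨0, hn⟩ 1 with hvd
  have hv : ‖v‖ = 1 := by simp [hvd]
  have hfr := finrank_orth hn v hv
  have hd : (0 : ℝ) ≤ (n : ℝ) - 1 := by
    have : (1 : ℝ) ≤ n := by exact_mod_cast hn
    linarith
  set U := (Submodule.span ℝ {v})ᗮ with hU
  have hL : LipschitzWith 1 (fun a : Euc n => U.orthogonalProjectionOnto a) :=
    U.lipschitzWith_orthogonalProjectionOnto
  have hle := hL.hausdorffMeasure_image_le hd (sphere (0 : Euc n) 1)
  have hsub : ball (0 : U) 1 ⊆ (fun a : Euc n => U.orthogonalProjectionOnto a) '' sphere 0 1 := by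
    intro w hw
    have hw1 : ‖(w : Euc n)‖ < 1 := by simpa using hw
    have hvw : ⟪(w : Euc n), v⟫ = 0 := by
      rw [real_inner_comm]
      exact Submodule.mem_orthogonal_singleton_iff_inner_right.1 w.2
    have hs : 0 ≤ 1 - ‖(w : Euc n)‖ ^ 2 := by nlinarith [norm_nonneg (w : Euc n)]
    refine ⟨(w : Euc n) + Real.sqrt (1 - ‖(w : Euc n)‖ ^ 2) • v, ?_, ?_⟩
    · have : ‖(w : Euc n) + Real.sqrt (1 - ‖(w : Euc n)‖ ^ 2) • v‖ ^ 2 = 1 := by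
        rw [norm_add_sq_real, inner_smul_right, hvw, norm_smul, hv, mul_one, Real.norm_eq_abs,
          sq_abs, Real.sq_sqrt hs]
        ring
      rw [mem_sphere_zero_iff_norm]
      exact (pow_eq_one_iff_of_nonneg (norm_nonneg _) two_ne_zero).1 this
    · have hv0 : U.orthogonalProjectionOnto v = 0 := by
        rw [Submodule.orthogonalProjectionOnto_eq_zero_iff, hU, Submodule.orthogonal_orthogonal]
        exact Submodule.mem_span_singleton_self v
      simp [hv0]
  intro h0
  rw [h0, mul_zero] at hle
  have h3 := (measure_mono hsub).trans hle
  rw [← hfr] at h3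
  exact (isOpen_ball.measure_pos _ (nonempty_ball.2 one_pos)).ne' (le_antisymm h3 bot_le)

theorem sphereUniform_prob {n : ℕ} (hn : 1 ≤ n) : IsProbabilityMeasure (sphereUniform n) := by
  constructor
  simp only [sphereUniform, Measure.smul_apply, Measure.restrict_apply_univ, smul_eq_mul]
  exact ENNReal.inv_mul_cancel (sphere_ne_zero hn) (sphere_lt_top hn).ne

theorem sphereUniform_norm {n : ℕ} : ∀ᵐ a ∂(sphereUniform n), ‖a‖ = 1 := by
  refine Measure.ae_smul_measure ?_ _
  filter_upwards [ae_restrict_mem (isClosed_sphere.measurableSet)] with a ha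
  simpa using ha

theorem sphereUniform_inv {n : ℕ} (L : Euc n ≃ₗᵢ[ℝ] Euc n) :
    MeasurePreserving L (sphereUniform n) (sphereUniform n) := by
  refine MeasurePreserving.smul_measure ?_ _
  have h := (L.toIsometryEquiv.measurePreserving_hausdorffMeasure ((n : ℝ) - 1)).restrict_preimage
    (s := sphere (0 : Euc n) 1) isClosed_sphere.measurableSet
  have h2 : (L.toIsometryEquiv ⁻¹' sphere (0 : Euc n) 1) = sphere (0 : Euc n) 1 := by
    ext a
    simp
  rw [h2] at h
  exact h


theorem moment_eq {n : ℕ} (u v : Euc n) (h : ‖u‖ = ‖v‖) :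
    ∫ a, ⟪a, u⟫ ^ 2 ∂(sphereUniform n) = ∫ a, ⟪a, v⟫ ^ 2 ∂(sphereUniform n) := by
  set L := (Submodule.span ℝ {u - v})ᗮ.reflection with hL
  have hLu : L u = v := Submodule.reflection_sub h
  rw [← (sphereUniform_inv L).integral_comp L.toHomeomorph.measurableEmbedding
    (fun a => ⟪a, v⟫ ^ 2)]
  refine integral_congr_ae (Filter.Eventually.of_forall fun a => ?_)
  simp only
  rw [← hLu, LinearIsometryEquiv.inner_map_map]

theorem integrable_of_bdd {n : ℕ} (hn : 1 ≤ n) {f : Euc n → ℝ} (hf : Measurable f) (C : ℝ)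
    (hC : ∀ a, ‖a‖ = 1 → |f a| ≤ C) : Integrable f (sphereUniform n) := by
  have := sphereUniform_prob hn
  refine Integrable.of_bound hf.aestronglyMeasurable C ?_
  filter_upwards [sphereUniform_norm (n := n)] with a ha
  exact hC a ha

theorem inner_sq_le {n : ℕ} (a v : Euc n) (ha : ‖a‖ = 1) : ⟪a, v⟫ ^ 2 ≤ ‖v‖ ^ 2 := by
  have := abs_real_inner_le_norm a v
  rw [ha, one_mul] at this
  exact sq_le_sq' (by linarith [neg_abs_le ⟪a, v⟫]) (le_trans (le_abs_self _) this)

theorem integrable_inner_sq {n : ℕ} (hn : 1 ≤ n) (v : Euc n) :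
    Integrable (fun a => ⟪a, v⟫ ^ 2) (sphereUniform n) := by
  refine integrable_of_bdd hn (by fun_prop) (‖v‖ ^ 2) fun a ha => ?_
  rw [abs_of_nonneg (sq_nonneg _)]
  exact inner_sq_le a v ha

theorem moment {n : ℕ} (hn : 1 ≤ n) (v : Euc n) :
    ∫ a, ⟪a, v⟫ ^ 2 ∂(sphereUniform n) = ‖v‖ ^ 2 / n := by
  have hp := sphereUniform_prob hn
  have hn0 : (n : ℝ) ≠ 0 := by
    have : n ≠ 0 := by omega
    exact_mod_cast this
  have h1 : ∀ i : Fin n, ∫ a, ⟪a, v⟫ ^ 2 ∂(sphereUniform n) =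
      ‖v‖ ^ 2 * ∫ a, (a i) ^ 2 ∂(sphereUniform n) := by
    intro i
    rw [moment_eq v (‖v‖ • EuclideanSpace.single i 1) (by simp [norm_smul]), ← integral_const_mul]
    refine integral_congr_ae (Filter.Eventually.of_forall fun a => ?_)
    simp [inner_smul_right, mul_pow, EuclideanSpace.inner_single_right]
  have h2 : ∑ i : Fin n, ∫ a, (a i) ^ 2 ∂(sphereUniform n) = 1 := by
    rw [← integral_finsetSum]
    · rw [integral_congr_ae (g := fun _ => (1 : ℝ))]
      · simp
      · filter_upwards [sphereUniform_norm (n := n)] with a ha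
        rw [← EuclideanSpace.real_norm_sq_eq, ha, one_pow]
    · intro i _
      have := integrable_inner_sq hn (EuclideanSpace.single i (1 : ℝ))
      simpa [EuclideanSpace.inner_single_right] using this
  have h3 : ∑ i : Fin n, ∫ a, ⟪a, v⟫ ^ 2 ∂(sphereUniform n) = ‖v‖ ^ 2 := by
    rw [Finset.sum_congr rfl fun i _ => h1 i, ← Finset.mul_sum, h2, mul_one]
  rw [Finset.sum_const, Finset.card_univ, Fintype.card_fin, nsmul_eq_mul] at h3
  field_simp
  linarith

/-- rotation in the plane spanned by `e₁, e₂`. -/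
noncomputable def rotFun {n : ℕ} (e₁ e₂ : Euc n) (t : ℝ) (a : Euc n) : Euc n :=
  a + ((Real.cos t - 1) * ⟪a, e₁⟫ - Real.sin t * ⟪a, e₂⟫) • e₁
    + (Real.sin t * ⟪a, e₁⟫ + (Real.cos t - 1) * ⟪a, e₂⟫) • e₂

theorem rotFun_norm {n : ℕ} (e₁ e₂ : Euc n) (h1 : ‖e₁‖ = 1) (h2 : ‖e₂‖ = 1) (h12 : ⟪e₁, e₂⟫ = 0)
    (t : ℝ) (a : Euc n) : ‖rotFun e₁ e₂ t a‖ = ‖a‖ := by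
  have : ‖rotFun e₁ e₂ t a‖ ^ 2 = ‖a‖ ^ 2 := by
    have hs := Real.sin_sq_add_cos_sq t
    rw [rotFun, norm_add_sq_real, norm_add_sq_real, norm_smul, norm_smul, h1, h2, mul_one, mul_one,
      Real.norm_eq_abs, Real.norm_eq_abs, sq_abs, sq_abs, inner_add_left, inner_smul_left,
      inner_smul_right, inner_smul_right, inner_smul_right, h12]
    simp only [conj_trivial]
    linear_combination (⟪a, e₁⟫ ^ 2 + ⟪a, e₂⟫ ^ 2) * hs
  exact (pow_left_inj₀ (norm_nonneg _) (norm_nonneg _) two_ne_zero).1 this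

noncomputable def rotL {n : ℕ} (e₁ e₂ : Euc n) (h1 : ‖e₁‖ = 1) (h2 : ‖e₂‖ = 1) (h12 : ⟪e₁, e₂⟫ = 0)
    (t : ℝ) : Euc n →ₗᵢ[ℝ] Euc n where
  toFun := rotFun e₁ e₂ t
  map_add' a b := by
    simp only [rotFun, inner_add_left]
    module
  map_smul' c a := by
    simp only [rotFun, inner_smul_left, RingHom.id_apply, conj_trivial]
    module
  norm_map' a := rotFun_norm e₁ e₂ h1 h2 h12 t a

theorem rot_integral {n : ℕ} (e₁ e₂ : Euc n) (h1 : ‖e₁‖ = 1) (h2 : ‖e₂‖ = 1) (h12 : ⟪e₁, e₂⟫ = 0)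
    (t : ℝ) (f : Euc n → ℝ) :
    ∫ a, f (rotFun e₁ e₂ t a) ∂(sphereUniform n) = ∫ a, f a ∂(sphereUniform n) := by
  set L := (rotL e₁ e₂ h1 h2 h12 t).toLinearIsometryEquiv rfl with hL
  exact (sphereUniform_inv L).integral_comp L.toHomeomorph.measurableEmbedding f

theorem rot_average {n : ℕ} (hn : 1 ≤ n) (e₁ e₂ : Euc n) (h1 : ‖e₁‖ = 1) (h2 : ‖e₂‖ = 1)
    (h12 : ⟪e₁, e₂⟫ = 0) (f : Euc n → ℝ) (hf : Measurable f) (C : ℝ) (hC : ∀ a, |f a| ≤ C) :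
    ∫ a, (∫ t in (0 : ℝ)..(2 * Real.pi), f (rotFun e₁ e₂ t a)) ∂(sphereUniform n) =
      2 * Real.pi * ∫ a, f a ∂(sphereUniform n) ∧
    Integrable (fun a => ∫ t in (0 : ℝ)..(2 * Real.pi), f (rotFun e₁ e₂ t a))
      (sphereUniform n) := by
  have hp := sphereUniform_prob hn
  have hpi : (0 : ℝ) ≤ 2 * Real.pi := by positivity
  have hm : Measurable (fun p : Euc n × ℝ => f (rotFun e₁ e₂ p.2 p.1)) := by
    refine hf.comp (Continuous.measurable ?_)
    unfold rotFun
    fun_prop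
  have hI : Integrable (Function.uncurry fun (a : Euc n) (t : ℝ) => f (rotFun e₁ e₂ t a))
      ((sphereUniform n).prod (volume.restrict (Ioc 0 (2 * Real.pi)))) :=
    Integrable.of_bound hm.aestronglyMeasurable C (Filter.Eventually.of_forall fun p => hC _)
  simp only [intervalIntegral.integral_of_le hpi]
  refine ⟨?_, hI.integral_prod_left⟩
  rw [integral_integral_swap hI]
  simp only [rot_integral e₁ e₂ h1 h2 h12]
  simp [hpi]

theorem rot_inner₁ {n : ℕ} (e₁ e₂ : Euc n) (h1 : ‖e₁‖ = 1) (h12 : ⟪e₁, e₂⟫ = 0)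
    (t : ℝ) (a : Euc n) : ⟪rotFun e₁ e₂ t a, e₁⟫ = Real.cos t * ⟪a, e₁⟫ - Real.sin t * ⟪a, e₂⟫ := by
  have h21 : ⟪e₂, e₁⟫ = 0 := by rw [real_inner_comm, h12]
  simp only [rotFun, inner_add_left, inner_smul_left, conj_trivial, h21,
    real_inner_self_eq_norm_sq, h1]
  ring

theorem rot_inner₂ {n : ℕ} (e₁ e₂ : Euc n) (h2 : ‖e₂‖ = 1) (h12 : ⟪e₁, e₂⟫ = 0)
    (t : ℝ) (a : Euc n) : ⟪rotFun e₁ e₂ t a, e₂⟫ = Real.sin t * ⟪a, e₁⟫ + Real.cos t * ⟪a, e₂⟫ := by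
  simp only [rotFun, inner_add_left, inner_smul_left, conj_trivial, h12,
    real_inner_self_eq_norm_sq, h2]
  ring

theorem rot_inner₃ {n : ℕ} (e₁ e₂ q : Euc n) (hq1 : ⟪e₁, q⟫ = 0) (hq2 : ⟪e₂, q⟫ = 0)
    (t : ℝ) (a : Euc n) : ⟪rotFun e₁ e₂ t a, q⟫ = ⟪a, q⟫ := by
  simp only [rotFun, inner_add_left, inner_smul_left, conj_trivial, hq1, hq2]
  ring


/-- the planar integrand -/
noncomputable def pl (h r α β k φ : ℝ) : ℝ :=
  open Classical in
  if sgn (r * Real.cos (φ - h)) ≠ sgn (r * Real.cos (φ + h)) then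
    (r * (α * Real.cos φ + β * Real.sin φ) + k) ^ 2 else 0

theorem sgn_pos {t : ℝ} (h : 0 < t) : sgn t = 1 := by simp [sgn, h.le]
theorem sgn_neg {t : ℝ} (h : t < 0) : sgn t = -1 := by simp [sgn, h]

theorem sgn_mul_pos {c t : ℝ} (h : 0 < c) : sgn (c * t) = sgn t := by
  simp [sgn, mul_nonneg_iff_of_pos_left h]

theorem prim_deriv (r α β k φ : ℝ) :
    HasDerivAt (fun φ => r ^ 2 * (α ^ 2 * (φ + Real.sin φ * Real.cos φ) / 2
      + β ^ 2 * (φ - Real.sin φ * Real.cos φ) / 2 + α * β * Real.sin φ ^ 2)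
      + 2 * r * k * (α * Real.sin φ - β * Real.cos φ) + k ^ 2 * φ)
      ((r * (α * Real.cos φ + β * Real.sin φ) + k) ^ 2) φ := by
  have hs := Real.hasDerivAt_sin φ
  have hc := Real.hasDerivAt_cos φ
  have hi := hasDerivAt_id' φ
  have h := ((((((hi.add (hs.mul hc)).const_mul (α ^ 2)).div_const 2).add
    (((hi.sub (hs.mul hc)).const_mul (β ^ 2)).div_const 2)).add
    ((hs.pow 2).const_mul (α * β))).const_mul (r ^ 2)).add
    (((hs.const_mul α).sub (hc.const_mul β)).const_mul (2 * r * k)) |>.add (hi.const_mul (k ^ 2))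
  refine h.congr_deriv ?_
  have := Real.sin_sq_add_cos_sq φ
  norm_num
  linear_combination (-(r ^ 2 * (α ^ 2 + β ^ 2) / 2)) * this

theorem arc_integral (r α β k a b : ℝ) :
    ∫ φ in a..b, (r * (α * Real.cos φ + β * Real.sin φ) + k) ^ 2 =
      (r ^ 2 * (α ^ 2 * (b + Real.sin b * Real.cos b) / 2
      + β ^ 2 * (b - Real.sin b * Real.cos b) / 2 + α * β * Real.sin b ^ 2)
      + 2 * r * k * (α * Real.sin b - β * Real.cos b) + k ^ 2 * b) -
      (r ^ 2 * (α ^ 2 * (a + Real.sin a * Real.cos a) / 2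
      + β ^ 2 * (a - Real.sin a * Real.cos a) / 2 + α * β * Real.sin a ^ 2)
      + 2 * r * k * (α * Real.sin a - β * Real.cos a) + k ^ 2 * a) := by
  rw [intervalIntegral.integral_eq_sub_of_hasDerivAt (fun φ _ => prim_deriv r α β k φ)]
  exact (Continuous.intervalIntegrable (by fun_prop) _ _)

theorem pl_meas (h r α β k : ℝ) : Measurable (pl h r α β k) := by
  classical
  have hsg : Measurable sgn := Measurable.ite measurableSet_Ici measurable_const measurable_const
  unfold pl
  refine Measurable.ite ?_ (by fun_prop) measurable_const
  exact (measurableSet_eq_fun (hsg.comp (by fun_prop)) (hsg.comp (by fun_prop))).compl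

theorem pl_intervalIntegrable (h r α β k a b : ℝ) :
    IntervalIntegrable (pl h r α β k) volume a b := by
  have hc : IntervalIntegrable (fun φ => (r * (α * Real.cos φ + β * Real.sin φ) + k) ^ 2)
    volume a b := Continuous.intervalIntegrable (by fun_prop) _ _
  refine hc.mono_fun (pl_meas h r α β k).aestronglyMeasurable
    (Filter.Eventually.of_forall fun φ => ?_)
  simp only [pl]
  split_ifs
  · exact le_rfl
  · rw [norm_zero]
    exact norm_nonneg _

theorem pl_periodic (h r α β k : ℝ) : Function.Periodic (pl h r α β k) (2 * Real.pi) := by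
  intro φ
  unfold pl
  rw [show φ + 2 * Real.pi - h = (φ - h) + 2 * Real.pi by ring,
    show φ + 2 * Real.pi + h = (φ + h) + 2 * Real.pi by ring]
  simp only [Real.cos_add_two_pi, Real.sin_add_two_pi]

theorem pl_integral {h r : ℝ} (h0 : 0 ≤ h) (h1 : h < Real.pi / 2) (hr : 0 < r) (α β k φ : ℝ) :
    ∫ t in (0 : ℝ)..(2 * Real.pi), pl h r α β k (φ + t) =
      r ^ 2 * (α ^ 2 * (2 * h - Real.sin (2 * h)) + β ^ 2 * (2 * h + Real.sin (2 * h)))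
        + 4 * k ^ 2 * h := by
  have hpi := Real.pi_pos
  rw [intervalIntegral.integral_comp_add_left (fun t => pl h r α β k t) φ, add_zero,
    (pl_periodic h r α β k).intervalIntegral_add_eq φ (Real.pi / 2 - h)]
  have hII := pl_intervalIntegrable h r α β k
  rw [← intervalIntegral.integral_add_adjacent_intervals (hII _ (Real.pi / 2 + Real.pi + h)) (hII _ _),
    ← intervalIntegral.integral_add_adjacent_intervals (hII _ (Real.pi / 2 + Real.pi - h)) (hII _ _),
    ← intervalIntegral.integral_add_adjacent_intervals (hII _ (Real.pi / 2 + h)) (hII _ _)]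
  have c1 : ∀ x, Real.pi / 2 < x → x < Real.pi / 2 + Real.pi → sgn (r * Real.cos x) = -1 :=
    fun x hx hx' => sgn_neg (mul_neg_of_pos_of_neg hr
      (Real.cos_neg_of_pi_div_two_lt_of_lt hx (by linarith)))
  have c2 : ∀ x, -(Real.pi / 2) < x → x < Real.pi / 2 → sgn (r * Real.cos x) = 1 :=
    fun x hx hx' => sgn_pos (mul_pos hr (Real.cos_pos_of_mem_Ioo ⟨hx, hx'⟩))
  have c3 : ∀ x, Real.pi / 2 + Real.pi < x → x < Real.pi / 2 + 2 * Real.pi →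
      sgn (r * Real.cos x) = 1 := by
    intro x hx hx'
    rw [← Real.cos_sub_two_pi]
    exact c2 _ (by linarith) (by linarith)
  have i1 : ∫ x in (Real.pi / 2 - h)..(Real.pi / 2 + h), pl h r α β k x =
      ∫ φ in (Real.pi / 2 - h)..(Real.pi / 2 + h),
        (r * (α * Real.cos φ + β * Real.sin φ) + k) ^ 2 := by
    refine intervalIntegral.integral_congr_Ioo_of_le (by linarith) fun x hx => ?_
    simp only [pl]
    rw [c2 (x - h) (by linarith [hx.1]) (by linarith [hx.2]),
      c1 (x + h) (by linarith [hx.1]) (by linarith [hx.2]), if_pos (by norm_num)]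
  have i2 : ∫ x in (Real.pi / 2 + h)..(Real.pi / 2 + Real.pi - h), pl h r α β k x =
      ∫ φ in (Real.pi / 2 + h)..(Real.pi / 2 + Real.pi - h), 0 := by
    refine intervalIntegral.integral_congr_Ioo_of_le (by linarith) fun x hx => ?_
    simp only [pl]
    rw [c1 (x - h) (by linarith [hx.1]) (by linarith [hx.2]),
      c1 (x + h) (by linarith [hx.1]) (by linarith [hx.2]), if_neg (by norm_num)]
  have i3 : ∫ x in (Real.pi / 2 + Real.pi - h)..(Real.pi / 2 + Real.pi + h), pl h r α β k x =
      ∫ φ in (Real.pi / 2 + Real.pi - h)..(Real.pi / 2 + Real.pi + h),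
        (r * (α * Real.cos φ + β * Real.sin φ) + k) ^ 2 := by
    refine intervalIntegral.integral_congr_Ioo_of_le (by linarith) fun x hx => ?_
    simp only [pl]
    rw [c1 (x - h) (by linarith [hx.1]) (by linarith [hx.2]),
      c3 (x + h) (by linarith [hx.1]) (by linarith [hx.2]), if_pos (by norm_num)]
  have i4 : ∫ x in (Real.pi / 2 + Real.pi + h)..(Real.pi / 2 - h + 2 * Real.pi), pl h r α β k x =
      ∫ φ in (Real.pi / 2 + Real.pi + h)..(Real.pi / 2 - h + 2 * Real.pi), 0 := by
    refine intervalIntegral.integral_congr_Ioo_of_le (by linarith) fun x hx => ?_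
    simp only [pl]
    rw [c3 (x - h) (by linarith [hx.1]) (by linarith [hx.2]),
      c3 (x + h) (by linarith [hx.1]) (by linarith [hx.2]), if_neg (by norm_num)]
  rw [i1, i2, i3, i4, arc_integral, arc_integral]
  have e1 : Real.sin (Real.pi / 2 + h) = Real.cos h := by rw [add_comm, Real.sin_add_pi_div_two]
  have e2 : Real.cos (Real.pi / 2 + h) = - Real.sin h := by rw [add_comm, Real.cos_add_pi_div_two]
  have e3 : Real.sin (Real.pi / 2 + Real.pi + h) = - Real.cos h := by
    rw [show Real.pi / 2 + Real.pi + h = (Real.pi / 2 + h) + Real.pi by ring, Real.sin_add_pi, e1]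
  have e4 : Real.cos (Real.pi / 2 + Real.pi + h) = Real.sin h := by
    rw [show Real.pi / 2 + Real.pi + h = (Real.pi / 2 + h) + Real.pi by ring, Real.cos_add_pi, e2,
      neg_neg]
  have e5 : Real.sin (Real.pi / 2 + Real.pi - h) = - Real.cos h := by
    rw [show Real.pi / 2 + Real.pi - h = (Real.pi / 2 - h) + Real.pi by ring, Real.sin_add_pi,
      Real.sin_pi_div_two_sub]
  have e6 : Real.cos (Real.pi / 2 + Real.pi - h) = - Real.sin h := by
    rw [show Real.pi / 2 + Real.pi - h = (Real.pi / 2 - h) + Real.pi by ring, Real.cos_add_pi,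
      Real.cos_pi_div_two_sub]
  rw [e1, e2, e3, e4, e5, e6, Real.sin_pi_div_two_sub, Real.cos_pi_div_two_sub, Real.sin_two_mul]
  simp only [intervalIntegral.integral_zero]
  ring


theorem wedge_meas {n : ℕ} (x z : Euc n) : MeasurableSet (wedge x z) := by
  have hsg : Measurable sgn := Measurable.ite measurableSet_Ici measurable_const measurable_const
  refine MeasurableSet.inter isClosed_sphere.measurableSet ?_
  exact (measurableSet_eq_fun (hsg.comp (by fun_prop)) (hsg.comp (by fun_prop))).compl

theorem quadForm_eq {n : ℕ} (hn : 1 ≤ n) (x z v : Euc n) :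
    quadForm (covMatOn (sphereUniform n) (wedge x z)) v =
      ∫ a, (wedge x z).indicator (fun a => ⟪a, v⟫ ^ 2) a ∂(sphereUniform n) := by
  rw [integral_indicator (wedge_meas x z)]
  have hint : ∀ i j : Fin n, Integrable (fun a : Euc n => v i * (a i * a j) * v j)
      ((sphereUniform n).restrict (wedge x z)) := by
    intro i j
    refine Integrable.restrict ?_
    refine integrable_of_bdd hn (by fun_prop) (|v i| * (1 * 1) * |v j|) fun a ha => ?_
    have hi : ∀ i, |a i| ≤ 1 := fun i => by
      have := PiLp.norm_apply_le a i
      rwa [ha] at this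
    rw [abs_mul, abs_mul, abs_mul]
    gcongr
    · exact hi i
    · exact hi j
  have hexp : ∀ a : Euc n, ⟪a, v⟫ ^ 2 = ∑ i, ∑ j, v i * (a i * a j) * v j := by
    intro a
    rw [sq, PiLp.inner_apply, Finset.sum_mul_sum]
    refine Finset.sum_congr rfl fun i _ => Finset.sum_congr rfl fun j _ => ?_
    simp
    ring
  simp only [hexp]
  rw [integral_finsetSum _ fun i _ => integrable_finsetSum _ fun j _ => hint i j]
  refine Finset.sum_congr rfl fun i _ => ?_
  rw [integral_finsetSum _ fun j _ => hint i j]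
  refine Finset.sum_congr rfl fun j _ => ?_
  rw [integral_mul_const, integral_const_mul]
  rfl

theorem polar (p q : ℝ) : ∃ r φ : ℝ, 0 ≤ r ∧ p = r * Real.cos φ ∧ q = r * Real.sin φ := by
  refine ⟨‖(⟨p, q⟩ : ℂ)‖, Complex.arg ⟨p, q⟩, norm_nonneg _, ?_, ?_⟩
  · rw [Complex.norm_mul_cos_arg]
  · rw [Complex.norm_mul_sin_arg]

theorem ind_eq {n : ℕ} {e₁ e₂ : Euc n} (h1 : ‖e₁‖ = 1) (h2 : ‖e₂‖ = 1) (h12 : ⟪e₁, e₂⟫ = 0)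
    {h c d : ℝ} (hc : 0 < c) (hd : 0 < d)
    (q : Euc n) (hq1 : ⟪e₁, q⟫ = 0) (hq2 : ⟪e₂, q⟫ = 0) (α β : ℝ) (a : Euc n)
    (ha : ‖a‖ = 1) (r φ : ℝ) (hp : ⟪a, e₁⟫ = r * Real.cos φ) (hs : ⟪a, e₂⟫ = r * Real.sin φ)
    (t : ℝ) :
    (wedge (c • (Real.cos h • e₁ + Real.sin h • e₂)) (d • (Real.cos h • e₁ - Real.sin h • e₂))
      ).indicator (fun a => ⟪a, α • e₁ + β • e₂ + q⟫ ^ 2) (rotFun e₁ e₂ t a) =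
      pl h r α β ⟪a, q⟫ (φ + t) := by
  classical
  have r1 : ⟪rotFun e₁ e₂ t a, e₁⟫ = r * Real.cos (φ + t) := by
    rw [rot_inner₁ e₁ e₂ h1 h12, hp, hs, Real.cos_add]
    ring
  have r2 : ⟪rotFun e₁ e₂ t a, e₂⟫ = r * Real.sin (φ + t) := by
    rw [rot_inner₂ e₁ e₂ h2 h12, hp, hs, Real.sin_add]
    ring
  have r3 := rot_inner₃ e₁ e₂ q hq1 hq2 t a
  have hx : ⟪rotFun e₁ e₂ t a, c • (Real.cos h • e₁ + Real.sin h • e₂)⟫ =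
      c * (r * Real.cos (φ + t - h)) := by
    rw [inner_smul_right, inner_add_right, inner_smul_right, inner_smul_right, r1, r2,
      Real.cos_sub]
    ring
  have hz : ⟪rotFun e₁ e₂ t a, d • (Real.cos h • e₁ - Real.sin h • e₂)⟫ =
      d * (r * Real.cos (φ + t + h)) := by
    rw [inner_smul_right, inner_sub_right, inner_smul_right, inner_smul_right, r1, r2,
      Real.cos_add (φ + t)]
    ring
  have hmem : rotFun e₁ e₂ t a ∈ wedge (c • (Real.cos h • e₁ + Real.sin h • e₂))
      (d • (Real.cos h • e₁ - Real.sin h • e₂)) ↔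
      sgn (r * Real.cos (φ + t - h)) ≠ sgn (r * Real.cos (φ + t + h)) := by
    have : rotFun e₁ e₂ t a ∈ sphere (0 : Euc n) 1 := by
      rw [mem_sphere_zero_iff_norm, rotFun_norm e₁ e₂ h1 h2 h12, ha]
    change (_ ∧ _) ↔ _
    rw [hx, hz, sgn_mul_pos hc, sgn_mul_pos hd]
    exact and_iff_right this
  have hv : ⟪rotFun e₁ e₂ t a, α • e₁ + β • e₂ + q⟫ =
      r * (α * Real.cos (φ + t) + β * Real.sin (φ + t)) + ⟪a, q⟫ := by
    rw [inner_add_right, inner_add_right, inner_smul_right, inner_smul_right, r1, r2, r3]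
    ring
  rw [indicator_apply, pl, hv]
  simp only [hmem]

theorem ind_meas {n : ℕ} (x z v : Euc n) :
    Measurable ((wedge x z).indicator (fun a => ⟪a, v⟫ ^ 2)) :=
  Measurable.indicator (by fun_prop) (wedge_meas x z)

theorem ind_bdd {n : ℕ} (x z v a : Euc n) :
    |(wedge x z).indicator (fun a => ⟪a, v⟫ ^ 2) a| ≤ ‖v‖ ^ 2 := by
  by_cases ha : a ∈ wedge x z
  · rw [indicator_of_mem ha, abs_of_nonneg (sq_nonneg _)]
    exact inner_sq_le a v (mem_sphere_zero_iff_norm.1 ha.1)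
  · rw [indicator_of_notMem ha, abs_zero]
    positivity

theorem upper {n : ℕ} {e₁ e₂ : Euc n} (h1 : ‖e₁‖ = 1) (h2 : ‖e₂‖ = 1) (h12 : ⟪e₁, e₂⟫ = 0)
    {h c d : ℝ} (h0 : 0 ≤ h) (hlt : h < Real.pi / 2) (hc : 0 < c) (hd : 0 < d)
    (hn : 1 ≤ n) (v : Euc n) (hv : ‖v‖ = 1) :
    quadForm (covMatOn (sphereUniform n)
      (wedge (c • (Real.cos h • e₁ + Real.sin h • e₂)) (d • (Real.cos h • e₁ - Real.sin h • e₂)))) v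
      ≤ (2 * h + Real.sin (2 * h)) / (n * Real.pi) := by
  have hp := sphereUniform_prob hn
  have hpi := Real.pi_pos
  have hn0 : (0 : ℝ) < n := by exact_mod_cast hn
  have hsin : 0 ≤ Real.sin (2 * h) := Real.sin_nonneg_of_nonneg_of_le_pi (by linarith) (by linarith)
  have h21 : ⟪e₂, e₁⟫ = 0 := by rw [real_inner_comm, h12]
  rw [quadForm_eq hn]
  obtain ⟨α, β, q, hvd, hq1, hq2⟩ : ∃ (α β : ℝ) (q : Euc n), v = α • e₁ + β • e₂ + q ∧
      ⟪e₁, q⟫ = 0 ∧ ⟪e₂, q⟫ = 0 := by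
    refine ⟨⟪e₁, v⟫, ⟪e₂, v⟫, v - ⟪e₁, v⟫ • e₁ - ⟪e₂, v⟫ • e₂, by abel, ?_, ?_⟩
    · rw [inner_sub_right, inner_sub_right, inner_smul_right, inner_smul_right, h12,
        real_inner_self_eq_norm_sq, h1]
      ring
    · rw [inner_sub_right, inner_sub_right, inner_smul_right, inner_smul_right, h21,
        real_inner_self_eq_norm_sq, h2]
      ring
  have hnorm : α ^ 2 + β ^ 2 + ‖q‖ ^ 2 = 1 := by
    have : ‖v‖ ^ 2 = α ^ 2 + β ^ 2 + ‖q‖ ^ 2 := by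
      rw [hvd, norm_add_sq_real, norm_add_sq_real, inner_add_left, inner_smul_left, inner_smul_left,
        inner_smul_left, inner_smul_right, hq1, hq2, h12, norm_smul, norm_smul, h1, h2]
      simp
    rw [← this, hv, one_pow]
  obtain ⟨hav, hai⟩ := rot_average hn e₁ e₂ h1 h2 h12 _
    (ind_meas (c • (Real.cos h • e₁ + Real.sin h • e₂)) (d • (Real.cos h • e₁ - Real.sin h • e₂)) v)
    _ (ind_bdd _ _ v)
  set B : Euc n → ℝ := fun a => (⟪a, e₁⟫ ^ 2 + ⟪a, e₂⟫ ^ 2) *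
    ((α ^ 2 + β ^ 2) * (2 * h + Real.sin (2 * h))) + ⟪a, q⟫ ^ 2 * (4 * h) with hB
  have i1 := integrable_inner_sq hn e₁
  have i2 := integrable_inner_sq hn e₂
  have i3 := integrable_inner_sq hn q
  have hBi : Integrable B (sphereUniform n) := ((i1.add i2).mul_const _).add (i3.mul_const _)
  have hBint : ∫ a, B a ∂(sphereUniform n) =
      2 / n * ((α ^ 2 + β ^ 2) * (2 * h + Real.sin (2 * h)) + ‖q‖ ^ 2 * (2 * h)) := by
    have i12 : Integrable (fun a => ⟪a, e₁⟫ ^ 2 + ⟪a, e₂⟫ ^ 2) (sphereUniform n) := i1.add i2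
    simp only [hB]
    rw [integral_add (i12.mul_const _) (i3.mul_const _), integral_mul_const,
      integral_mul_const, integral_add i1 i2, moment hn, moment hn, moment hn, h1, h2]
    ring
  have hle : ∫ a, (∫ t in (0 : ℝ)..(2 * Real.pi), (wedge (c • (Real.cos h • e₁ + Real.sin h • e₂))
      (d • (Real.cos h • e₁ - Real.sin h • e₂))).indicator (fun a => ⟪a, v⟫ ^ 2)
        (rotFun e₁ e₂ t a)) ∂(sphereUniform n) ≤ ∫ a, B a ∂(sphereUniform n) := by
    refine integral_mono_ae hai hBi ?_
    filter_upwards [sphereUniform_norm (n := n)] with a ha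
    obtain ⟨r, φ, hr, hp, hs⟩ := polar ⟪a, e₁⟫ ⟪a, e₂⟫
    rw [hvd]
    simp only [ind_eq h1 h2 h12 hc hd q hq1 hq2 α β a ha r φ hp hs]
    have hr2 : ⟪a, e₁⟫ ^ 2 + ⟪a, e₂⟫ ^ 2 = r ^ 2 := by
      rw [hp, hs]
      linear_combination r ^ 2 * Real.sin_sq_add_cos_sq φ
    simp only [hB, hr2]
    rcases hr.eq_or_lt with hr0 | hr0
    · have : ∀ t, pl h r α β ⟪a, q⟫ (φ + t) = 0 := by
        intro t
        simp [pl, ← hr0]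
      simp only [this, intervalIntegral.integral_zero]
      positivity
    · rw [pl_integral h0 hlt hr0]
      have : 0 ≤ r ^ 2 * α ^ 2 * Real.sin (2 * h) := by positivity
      nlinarith
  rw [hav, hBint] at hle
  rw [le_div_iff₀ (by positivity)]
  have hq : ‖q‖ ^ 2 * Real.sin (2 * h) ≥ 0 := by positivity
  have hfin : (α ^ 2 + β ^ 2) * (2 * h + Real.sin (2 * h)) + ‖q‖ ^ 2 * (2 * h) ≤
      2 * h + Real.sin (2 * h) := by
    have : α ^ 2 + β ^ 2 = 1 - ‖q‖ ^ 2 := by linarith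
    rw [this]
    linarith
  have h4 := hle.trans (mul_le_mul_of_nonneg_left hfin (by positivity : (0 : ℝ) ≤ 2 / n))
  rw [div_mul_eq_mul_div, le_div_iff₀ hn0] at h4
  linarith

theorem lower {n : ℕ} {e₁ e₂ : Euc n} (h1 : ‖e₁‖ = 1) (h2 : ‖e₂‖ = 1) (h12 : ⟪e₁, e₂⟫ = 0)
    {h c d : ℝ} (h0 : 0 ≤ h) (hlt : h < Real.pi / 2) (hc : 0 < c) (hd : 0 < d)
    (hn : 1 ≤ n) :
    quadForm (covMatOn (sphereUniform n)
      (wedge (c • (Real.cos h • e₁ + Real.sin h • e₂)) (d • (Real.cos h • e₁ - Real.sin h • e₂)))) e₂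
      = (2 * h + Real.sin (2 * h)) / (n * Real.pi) := by
  have hp := sphereUniform_prob hn
  have hpi := Real.pi_pos
  have hn0 : (0 : ℝ) < n := by exact_mod_cast hn
  rw [quadForm_eq hn]
  obtain ⟨hav, hai⟩ := rot_average hn e₁ e₂ h1 h2 h12 _
    (ind_meas (c • (Real.cos h • e₁ + Real.sin h • e₂)) (d • (Real.cos h • e₁ - Real.sin h • e₂)) e₂)
    _ (ind_bdd _ _ e₂)
  have i1 := integrable_inner_sq hn e₁
  have i2 := integrable_inner_sq hn e₂
  have heq : ∫ a, (∫ t in (0 : ℝ)..(2 * Real.pi), (wedge (c • (Real.cos h • e₁ + Real.sin h • e₂))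
      (d • (Real.cos h • e₁ - Real.sin h • e₂))).indicator (fun a => ⟪a, e₂⟫ ^ 2)
        (rotFun e₁ e₂ t a)) ∂(sphereUniform n) =
      ∫ a, (⟪a, e₁⟫ ^ 2 + ⟪a, e₂⟫ ^ 2) * (2 * h + Real.sin (2 * h)) ∂(sphereUniform n) := by
    refine integral_congr_ae ?_
    filter_upwards [sphereUniform_norm (n := n)] with a ha
    obtain ⟨r, φ, hr, hp, hs⟩ := polar ⟪a, e₁⟫ ⟪a, e₂⟫
    have key := ind_eq (h := h) h1 h2 h12 hc hd 0 (by simp) (by simp) 0 1 a ha r φ hp hs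
    have hve : (0 : ℝ) • e₁ + (1 : ℝ) • e₂ + 0 = e₂ := by simp
    rw [hve] at key
    simp only [key]
    have hr2 : ⟪a, e₁⟫ ^ 2 + ⟪a, e₂⟫ ^ 2 = r ^ 2 := by
      rw [hp, hs]
      linear_combination r ^ 2 * Real.sin_sq_add_cos_sq φ
    rw [hr2]
    rcases hr.eq_or_lt with hr0 | hr0
    · have : ∀ t, pl h r 0 1 ⟪a, (0 : Euc n)⟫ (φ + t) = 0 := by
        intro t
        simp [pl, ← hr0]
      simp only [this, intervalIntegral.integral_zero]
      simp [← hr0]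
    · rw [pl_integral h0 hlt hr0, inner_zero_right]
      ring
  rw [hav, integral_mul_const, integral_add i1 i2, moment hn, moment hn, h1, h2] at heq
  rw [eq_div_iff (by positivity)]
  field_simp at heq
  linarith

theorem angle_lt {n : ℕ} (x z : Euc n) (hx : x ≠ 0) (hz : z ≠ 0) (hxz : 0 < ⟪x, z⟫) :
    InnerProductGeometry.angle x z < Real.pi / 2 := by
  rw [InnerProductGeometry.angle, Real.arccos_lt_pi_div_two]
  have := norm_pos_iff.2 hx
  have := norm_pos_iff.2 hz
  positivity

/-- Any two nonzero vectors are symmetric about their bisector. -/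
theorem frame {n : ℕ} (hn : 2 ≤ n) (x z : Euc n) (hx : x ≠ 0) (hz : z ≠ 0) (hxz : 0 < ⟪x, z⟫) :
    ∃ e₁ e₂ : Euc n, ‖e₁‖ = 1 ∧ ‖e₂‖ = 1 ∧ ⟪e₁, e₂⟫ = 0 ∧
      x = ‖x‖ • (Real.cos (InnerProductGeometry.angle x z / 2) • e₁ +
        Real.sin (InnerProductGeometry.angle x z / 2) • e₂) ∧
      z = ‖z‖ • (Real.cos (InnerProductGeometry.angle x z / 2) • e₁ -
        Real.sin (InnerProductGeometry.angle x z / 2) • e₂) := by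
  set θ := InnerProductGeometry.angle x z with hθ
  have hxn : 0 < ‖x‖ := norm_pos_iff.2 hx
  have hzn : 0 < ‖z‖ := norm_pos_iff.2 hz
  have hlt : θ < Real.pi / 2 := angle_lt x z hx hz hxz
  have h0 : 0 ≤ θ := InnerProductGeometry.angle_nonneg x z
  have hpi := Real.pi_pos
  have hcos : 0 < Real.cos (θ / 2) := Real.cos_pos_of_mem_Ioo ⟨by linarith, by linarith⟩
  set u := ‖x‖⁻¹ • x with hu
  set w := ‖z‖⁻¹ • z with hw
  have hxu : x = ‖x‖ • u := by rw [hu, smul_smul, mul_inv_cancel₀ hxn.ne', one_smul]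
  have hzw : z = ‖z‖ • w := by rw [hw, smul_smul, mul_inv_cancel₀ hzn.ne', one_smul]
  have hu1 : ‖u‖ = 1 := by rw [hu, norm_smul, norm_inv, norm_norm, inv_mul_cancel₀ hxn.ne']
  have hw1 : ‖w‖ = 1 := by rw [hw, norm_smul, norm_inv, norm_norm, inv_mul_cancel₀ hzn.ne']
  have huw : ⟪u, w⟫ = Real.cos θ := by
    rw [hθ, InnerProductGeometry.cos_angle, hu, hw, inner_smul_left, inner_smul_right]
    simp only [conj_trivial]
    field_simp
  have hc2 : Real.cos θ = 2 * Real.cos (θ / 2) ^ 2 - 1 := by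
    rw [← Real.cos_two_mul]
    congr 1
    ring
  have hsc := Real.sin_sq_add_cos_sq (θ / 2)
  suffices H : ∃ e₁ e₂ : Euc n, ‖e₁‖ = 1 ∧ ‖e₂‖ = 1 ∧ ⟪e₁, e₂⟫ = 0 ∧
      u = Real.cos (θ / 2) • e₁ + Real.sin (θ / 2) • e₂ ∧
      w = Real.cos (θ / 2) • e₁ - Real.sin (θ / 2) • e₂ by
    obtain ⟨e₁, e₂, a1, a2, a3, a4, a5⟩ := H
    exact ⟨e₁, e₂, a1, a2, a3, by rw [← a4]; exact hxu, by rw [← a5]; exact hzw⟩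
  rcases h0.eq_or_lt with h00 | hpos
  · rw [← h00] at huw ⊢
    rw [Real.cos_zero] at huw
    have huw' : u = w := (inner_eq_one_iff_of_norm_eq_one hu1 hw1).1 huw
    obtain ⟨e, he, hue⟩ : ∃ e : Euc n, ‖e‖ = 1 ∧ ⟪u, e⟫ = 0 := by
      have hu0 : u ≠ 0 := by
        intro h
        rw [h, norm_zero] at hu1
        norm_num at hu1
      have hf := finrank_orth (by omega) u hu1
      have hpos : 0 < finrank ℝ (Submodule.span ℝ {u})ᗮ := by
        have : (2 : ℝ) ≤ n := by exact_mod_cast hn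
        have : (0 : ℝ) < (finrank ℝ (Submodule.span ℝ {u})ᗮ : ℕ) := by linarith
        exact_mod_cast this
      have := Module.finrank_pos_iff.1 hpos
      obtain ⟨e, he⟩ := exists_norm_eq (Submodule.span ℝ {u})ᗮ zero_le_one
      exact ⟨e, by simpa using he, Submodule.mem_orthogonal_singleton_iff_inner_right.1 e.2⟩
    refine ⟨u, e, hu1, he, hue, ?_, ?_⟩
    · simp
    · simp [huw']
  · have hsin : 0 < Real.sin (θ / 2) := Real.sin_pos_of_pos_of_lt_pi (by linarith) (by linarith)
    refine ⟨(2 * Real.cos (θ / 2))⁻¹ • (u + w), (2 * Real.sin (θ / 2))⁻¹ • (u - w), ?_, ?_, ?_, ?_, ?_⟩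
    · have : ‖u + w‖ ^ 2 = (2 * Real.cos (θ / 2)) ^ 2 := by
        rw [norm_add_sq_real, hu1, hw1, huw, hc2]
        ring
      have := (pow_left_inj₀ (norm_nonneg _) (by positivity) two_ne_zero).1 this
      rw [norm_smul, this, Real.norm_eq_abs, abs_of_pos (by positivity)]
      field_simp
    · have : ‖u - w‖ ^ 2 = (2 * Real.sin (θ / 2)) ^ 2 := by
        rw [norm_sub_sq_real, hu1, hw1, huw, hc2]
        linear_combination (-4) * hsc
      have := (pow_left_inj₀ (norm_nonneg _) (by positivity) two_ne_zero).1 this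
      rw [norm_smul, this, Real.norm_eq_abs, abs_of_pos (by positivity)]
      field_simp
    · rw [inner_smul_left, inner_smul_right, inner_add_left, inner_sub_right, inner_sub_right,
        real_inner_self_eq_norm_sq, real_inner_self_eq_norm_sq, hu1, hw1, real_inner_comm u w]
      ring
    · rw [smul_smul, smul_smul,
        show Real.cos (θ / 2) * (2 * Real.cos (θ / 2))⁻¹ = 1 / 2 by field_simp,
        show Real.sin (θ / 2) * (2 * Real.sin (θ / 2))⁻¹ = 1 / 2 by field_simp]
      module
    · rw [smul_smul, smul_smul,
        show Real.cos (θ / 2) * (2 * Real.cos (θ / 2))⁻¹ = 1 / 2 by field_simp,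
        show Real.sin (θ / 2) * (2 * Real.sin (θ / 2))⁻¹ = 1 / 2 by field_simp]
      module

end WedgeProof

/-- For `a` uniform on `S^{n−1}` (`n ≥ 3`) and nonzero `x, z` with `⟨x,z⟩ > 0` making
angle `θ`, the matrix `M = E[aaᵀ 1_{W_{x,z}}(a)]` has `λ_max(M) = (θ + sin θ)/(nπ)`. -/
theorem lamMax_covMatOn_wedge {n : ℕ} (hn : 3 ≤ n) (x z : Euc n) (hx : x ≠ 0)
    (hz : z ≠ 0) (hxz : 0 < ⟪x, z⟫) :
    lamMax (covMatOn (sphereUniform n) (wedge x z)) =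
      (InnerProductGeometry.angle x z + Real.sin (InnerProductGeometry.angle x z)) /
        (n * Real.pi) := by

  obtain ⟨e₁, e₂, h1, h2, h12, hxe, hze⟩ := WedgeProof.frame (by omega) x z hx hz hxz
  have hlt : InnerProductGeometry.angle x z < Real.pi / 2 :=
    WedgeProof.angle_lt x z hx hz hxz
  have h0 : 0 ≤ InnerProductGeometry.angle x z := InnerProductGeometry.angle_nonneg x z
  have hpi := Real.pi_pos
  have hu := WedgeProof.upper h1 h2 h12 (h := InnerProductGeometry.angle x z / 2) (by linarith)
    (by linarith) (norm_pos_iff.2 hx) (norm_pos_iff.2 hz) (by omega)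
  have hl := WedgeProof.lower h1 h2 h12 (h := InnerProductGeometry.angle x z / 2) (by linarith)
    (by linarith) (norm_pos_iff.2 hx) (norm_pos_iff.2 hz) (by omega)
  rw [← hxe, ← hze, mul_div_cancel₀ _ (two_ne_zero)] at hu hl
  have hne : Nonempty {v : Euc n // ‖v‖ = 1} := ⟨⟨e₂, h2⟩⟩
  apply le_antisymm
  · exact ciSup_le fun v => hu v v.2
  · rw [← hl]
    exact le_ciSup (f := fun v : {v : Euc n // ‖v‖ = 1} =>
      quadForm (covMatOn (sphereUniform n) (wedge x z)) (v : Euc n))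
      ⟨_, by rintro _ ⟨v, rfl⟩; exact hu v v.2⟩ ⟨e₂, h2⟩
end

section
/- Fix vectors x, z ∈ ℝⁿ (n ≥ 3) with ⟨z, x⟩ > 0, and let P = P_σ be the generalized Kaczmarz projection with respect to σ, the uniform probability measure on the sphere S^{n−1}. Let θ be the angle between z and x. Then E‖Pz − x‖₂² ≤ [1 − (1 − 4(θ + sin θ)/π)/n]·‖z − x‖₂². -/
open MeasureTheory ProbabilityTheory
open scoped RealInnerProductSpace ENNReal BigOperators

namespace KacAux

lemma angle_ineq {θ : ℝ} (h0 : 0 ≤ θ) (h1 : θ < Real.pi / 2) :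
    θ - Real.sin θ * Real.cos θ ≤ (θ + Real.sin θ) * Real.sin θ ^ 2 := by
  have hc : 0 < Real.cos θ := Real.cos_pos_of_mem_Ioo ⟨by linarith, h1⟩
  have hs : 0 ≤ Real.sin θ := Real.sin_nonneg_of_nonneg_of_le_pi h0 (by linarith)
  have ht := Real.le_tan h0 h1
  rw [Real.tan_eq_sin_div_cos, le_div_iff₀ hc] at ht
  have h2 := Real.sin_sq_add_cos_sq θ
  have h3 : Real.cos θ * (θ * Real.cos θ - Real.sin θ) ≤ 0 :=
    mul_nonpos_of_nonneg_of_nonpos hc.le (by linarith)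
  have h4 : 0 ≤ Real.sin θ ^ 3 := by positivity
  have h5 : Real.sin θ ^ 2 = 1 - Real.cos θ ^ 2 := by linarith
  have : θ - θ * Real.sin θ ^ 2 = θ * Real.cos θ ^ 2 := by rw [h5]; ring
  nlinarith

/-- The angular profile. -/
noncomputable def prof (θ φ : ℝ) : ℝ :=
  if sgn (Real.cos φ) = sgn (Real.cos (φ - θ)) then 0 else Real.cos φ ^ 2

lemma measurable_sgn : Measurable sgn :=
  Measurable.ite measurableSet_Ici measurable_const measurable_const

lemma measurable_prof (θ : ℝ) : Measurable (prof θ) := by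
  unfold prof
  refine Measurable.ite ?_ measurable_const (by fun_prop)
  exact measurableSet_eq_fun (measurable_sgn.comp (by fun_prop)) (measurable_sgn.comp (by fun_prop))

lemma prof_nonneg (θ φ : ℝ) : 0 ≤ prof θ φ := by
  unfold prof; split_ifs <;> positivity

lemma prof_le (θ φ : ℝ) : prof θ φ ≤ Real.cos φ ^ 2 := by
  unfold prof; split_ifs
  · positivity
  · exact le_rfl

lemma prof_int (θ a b : ℝ) : IntervalIntegrable (prof θ) volume a b := by
  have h : IntervalIntegrable (fun φ => Real.cos φ ^ 2) volume a b :=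
    (by fun_prop : Continuous fun φ => Real.cos φ ^ 2).intervalIntegrable a b
  refine h.mono_fun (measurable_prof θ).aestronglyMeasurable (Filter.Eventually.of_forall fun φ => ?_)
  change ‖prof θ φ‖ ≤ ‖Real.cos φ ^ 2‖
  rw [Real.norm_of_nonneg (prof_nonneg _ _), Real.norm_of_nonneg (by positivity)]
  exact prof_le _ _

lemma prof_periodic (θ : ℝ) : Function.Periodic (prof θ) (2 * Real.pi) := by
  intro φ
  unfold prof
  rw [Real.cos_add_two_pi, show φ + 2 * Real.pi - θ = (φ - θ) + 2 * Real.pi by ring,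
    Real.cos_add_two_pi]

lemma prof_integral_le {θ : ℝ} (h0 : 0 ≤ θ) (h1 : θ < Real.pi / 2) (t : ℝ) :
    ∫ φ in t..(t + 2 * Real.pi), prof θ φ ≤ θ - Real.sin θ * Real.cos θ := by
  have hpi := Real.pi_pos
  rw [(prof_periodic θ).intervalIntegral_add_eq t (-(Real.pi / 2))]
  have e1 := intervalIntegral.integral_add_adjacent_intervals
    (prof_int θ (-(Real.pi/2)) (-(Real.pi/2) + θ)) (prof_int θ (-(Real.pi/2)+θ) (Real.pi/2))
  have e2 := intervalIntegral.integral_add_adjacent_intervals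
    (prof_int θ (-(Real.pi/2)) (Real.pi/2)) (prof_int θ (Real.pi/2) (Real.pi/2+θ))
  have e3 := intervalIntegral.integral_add_adjacent_intervals
    (prof_int θ (-(Real.pi/2)) (Real.pi/2+θ)) (prof_int θ (Real.pi/2+θ) (-(Real.pi/2) + 2 * Real.pi))
  have hci : ∀ a b, IntervalIntegrable (fun φ => Real.cos φ ^ 2) volume a b := fun a b =>
    (by fun_prop : Continuous fun φ => Real.cos φ ^ 2).intervalIntegrable a b
  have b1 : ∫ φ in (-(Real.pi/2))..(-(Real.pi/2) + θ), prof θ φ ≤ _ :=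
    intervalIntegral.integral_mono_on (by linarith) (prof_int θ _ _) (hci _ _)
      (fun φ _ => prof_le θ φ)
  have b3 : ∫ φ in (Real.pi/2)..(Real.pi/2 + θ), prof θ φ ≤ _ :=
    intervalIntegral.integral_mono_on (by linarith) (prof_int θ _ _) (hci _ _)
      (fun φ _ => prof_le θ φ)
  have b2 : ∫ φ in (-(Real.pi/2)+θ)..(Real.pi/2), prof θ φ ≤ ∫ φ in (-(Real.pi/2)+θ)..(Real.pi/2), (0:ℝ) := by
    refine intervalIntegral.integral_mono_on (by linarith) (prof_int θ _ _) (by simp) ?_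
    intro φ hφ
    have c1 : 0 ≤ Real.cos φ := Real.cos_nonneg_of_mem_Icc ⟨by linarith [hφ.1], hφ.2⟩
    have c2 : 0 ≤ Real.cos (φ - θ) :=
      Real.cos_nonneg_of_mem_Icc ⟨by linarith [hφ.1], by linarith [hφ.2]⟩
    simp [prof, sgn, c1, c2]
  have b4 : ∫ φ in (Real.pi/2+θ)..(-(Real.pi/2) + 2 * Real.pi), prof θ φ ≤
      ∫ φ in (Real.pi/2+θ)..(-(Real.pi/2) + 2 * Real.pi), (0:ℝ) := by
    refine intervalIntegral.integral_mono_on_of_le_Ioo (by linarith) (prof_int θ _ _) (by simp) ?_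
    intro φ hφ
    have c1 : Real.cos φ < 0 :=
      Real.cos_neg_of_pi_div_two_lt_of_lt (by linarith [hφ.1]) (by linarith [hφ.2])
    have c2 : Real.cos (φ - θ) < 0 :=
      Real.cos_neg_of_pi_div_two_lt_of_lt (by linarith [hφ.1]) (by linarith [hφ.2])
    simp [prof, sgn, c1.not_ge, c2.not_ge]
  rw [integral_cos_sq] at b1 b3
  have t1 : Real.cos (-(Real.pi/2) + θ) = Real.sin θ := by
    rw [Real.cos_add]; simp
  have t2 : Real.sin (-(Real.pi/2) + θ) = - Real.cos θ := by
    rw [Real.sin_add]; simp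
  have t3 : Real.cos (Real.pi/2 + θ) = - Real.sin θ := by
    rw [Real.cos_add]; simp
  have t4 : Real.sin (Real.pi/2 + θ) = Real.cos θ := by
    rw [Real.sin_add]; simp
  rw [t1, t2, Real.cos_neg, Real.cos_pi_div_two] at b1
  rw [t3, t4, Real.cos_pi_div_two] at b3
  rw [intervalIntegral.integral_zero] at b2 b4
  linarith

variable {n : ℕ}

lemma ae_norm (n : ℕ) : ∀ᵐ a ∂(sphereUniform n), ‖a‖ = 1 := by
  unfold sphereUniform
  refine Measure.ae_smul_measure ?_ _
  filter_upwards [ae_restrict_mem Metric.isClosed_sphere.measurableSet] with a ha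
  simpa using ha

lemma mp (L : Euc n ≃ₗᵢ[ℝ] Euc n) : MeasurePreserving L (sphereUniform n) (sphereUniform n) := by
  unfold sphereUniform
  refine MeasurePreserving.smul_measure ?_ _
  have h := (L.toIsometryEquiv.measurePreserving_hausdorffMeasure ((n:ℝ)-1)).restrict_preimage
    (s := Metric.sphere (0 : Euc n) 1) Metric.isClosed_sphere.measurableSet
  have e : (L.toIsometryEquiv : Euc n → Euc n) ⁻¹' (Metric.sphere (0 : Euc n) 1)
      = Metric.sphere (0 : Euc n) 1 := by
    ext a; simp
  rw [e] at h
  exact h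

lemma integral_comp_iso (L : Euc n ≃ₗᵢ[ℝ] Euc n) (f : Euc n → ℝ) :
    ∫ a, f (L a) ∂(sphereUniform n) = ∫ a, f a ∂(sphereUniform n) :=
  (mp L).integral_comp L.toHomeomorph.measurableEmbedding f

lemma prob_or_zero (n : ℕ) : IsProbabilityMeasure (sphereUniform n) ∨ sphereUniform n = 0 := by
  by_cases h0 : μH[(n : ℝ) - 1] (Metric.sphere (0 : Euc n) 1) = 0
  · right
    unfold sphereUniform
    rw [Measure.restrict_eq_zero.2 h0, smul_zero]
  by_cases h1 : μH[(n : ℝ) - 1] (Metric.sphere (0 : Euc n) 1) = ⊤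
  · right
    unfold sphereUniform
    rw [h1, ENNReal.inv_top, zero_smul]
  · left
    constructor
    unfold sphereUniform
    rw [Measure.smul_apply, Measure.restrict_apply_univ, smul_eq_mul, ENNReal.inv_mul_cancel h0 h1]

lemma int_sq [IsProbabilityMeasure (sphereUniform n)] (v : Euc n) :
    Integrable (fun a => ⟪a, v⟫ ^ 2) (sphereUniform n) := by
  refine Integrable.of_bound (C := ‖v‖ ^ 2)
    (by fun_prop : Continuous fun a : Euc n => ⟪a, v⟫ ^ 2).aestronglyMeasurable ?_
  filter_upwards [ae_norm n] with a ha
  have := abs_real_inner_le_norm a v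
  rw [ha, one_mul] at this
  rw [norm_pow, Real.norm_eq_abs]
  gcongr

lemma integral_sq [IsProbabilityMeasure (sphereUniform n)] (hn : 0 < n) (v : Euc n) :
    ∫ a, ⟪a, v⟫ ^ 2 ∂(sphereUniform n) = ‖v‖ ^ 2 / n := by
  have key : ∀ i : Fin n, ∫ a, ‖v‖ ^ 2 * (a i) ^ 2 ∂(sphereUniform n) =
      ∫ a, ⟪a, v⟫ ^ 2 ∂(sphereUniform n) := by
    intro i
    set w : Euc n := ‖v‖ • EuclideanSpace.single i (1:ℝ) with hw
    have hnorm : ‖w‖ = ‖v‖ := by simp [hw, norm_smul]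
    let L : Euc n ≃ₗᵢ[ℝ] Euc n := (ℝ ∙ (w - v))ᗮ.reflection
    have hL : L w = v := Submodule.reflection_sub hnorm
    rw [← integral_comp_iso L (fun a => ⟪a, v⟫ ^ 2)]
    congr 1; ext a
    have hin : ⟪L a, v⟫ = ‖v‖ * a i := by
      have h3 : ⟪L a, v⟫ = ⟪L a, L w⟫ := by rw [hL]
      rw [h3, L.inner_map_map, hw, inner_smul_right]
      simp [EuclideanSpace.inner_single_right]
    rw [hin, mul_pow]
  have hsum : ∑ i : Fin n, ∫ a, ‖v‖ ^ 2 * (a i) ^ 2 ∂(sphereUniform n) = ‖v‖ ^ 2 := by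
    rw [← integral_finsetSum]
    · have : ∀ᵐ a ∂(sphereUniform n), ∑ i : Fin n, ‖v‖ ^ 2 * (a i) ^ 2 = ‖v‖ ^ 2 := by
        filter_upwards [ae_norm n] with a ha
        rw [← Finset.mul_sum, ← EuclideanSpace.real_norm_sq_eq, ha]; ring
      rw [integral_congr_ae this]; simp
    · intro i _
      have := (int_sq (n := n) (EuclideanSpace.single i (1:ℝ))).const_mul (‖v‖ ^ 2)
      simpa [EuclideanSpace.inner_single_right] using this
  rw [Finset.sum_congr rfl (fun i _ => key i)] at hsum
  simp at hsum
  rw [eq_div_iff (by positivity)]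
  linarith

/-- Rotation by `φ` in the plane spanned by `e1`, `e2`. -/
noncomputable def rotFun (e1 e2 : Euc n) (φ : ℝ) (a : Euc n) : Euc n :=
  a + ((Real.cos φ - 1) * ⟪a, e1⟫ - Real.sin φ * ⟪a, e2⟫) • e1
    + ((Real.cos φ - 1) * ⟪a, e2⟫ + Real.sin φ * ⟪a, e1⟫) • e2

lemma rot_iso {e1 e2 : Euc n} (h1 : ⟪e1, e1⟫ = 1) (h2 : ⟪e2, e2⟫ = 1) (h12 : ⟪e1, e2⟫ = 0)
    (φ : ℝ) : ∃ L : Euc n ≃ₗᵢ[ℝ] Euc n, ∀ a, L a = rotFun e1 e2 φ a := by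
  let T : Euc n →ₗ[ℝ] Euc n :=
    { toFun := rotFun e1 e2 φ
      map_add' := by
        intro a b
        simp only [rotFun, inner_add_left]
        module
      map_smul' := by
        intro c a
        simp only [rotFun, inner_smul_left, RingHom.id_apply, conj_trivial]
        module }
  have h21 : ⟪e2, e1⟫ = 0 := by rw [real_inner_comm]; exact h12
  have hT : ∀ a, ‖T a‖ = ‖a‖ := by
    intro a
    have hsq : ‖T a‖ ^ 2 = ‖a‖ ^ 2 := by
      rw [← real_inner_self_eq_norm_sq, ← real_inner_self_eq_norm_sq]
      change ⟪rotFun e1 e2 φ a, rotFun e1 e2 φ a⟫ = _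
      simp only [rotFun, inner_add_left, inner_add_right, inner_smul_left, inner_smul_right,
        h1, h2, h12, h21, conj_trivial, real_inner_comm a e1, real_inner_comm a e2]
      have hsc := Real.sin_sq_add_cos_sq φ
      have hs : Real.sin φ ^ 2 = 1 - Real.cos φ ^ 2 := by linarith
      ring_nf
      rw [hs]; ring
    exact (sq_eq_sq₀ (norm_nonneg _) (norm_nonneg _)).1 hsq
  let Li : Euc n →ₗᵢ[ℝ] Euc n := ⟨T, hT⟩
  exact ⟨Li.toLinearIsometryEquiv rfl, fun a => rfl⟩

/-- The excess on the wedge. -/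
noncomputable def exc (x z a : Euc n) : ℝ :=
  if sgn ⟪a, x⟫ = sgn ⟪a, z⟫ then 0 else ⟪a, x⟫ ^ 2

lemma measurable_exc (x z : Euc n) : Measurable (exc x z) := by
  unfold exc
  refine Measurable.ite ?_ measurable_const (by fun_prop)
  exact measurableSet_eq_fun (measurable_sgn.comp (by fun_prop)) (measurable_sgn.comp (by fun_prop))

lemma exc_nonneg (x z a : Euc n) : 0 ≤ exc x z a := by
  unfold exc; split_ifs <;> positivity

lemma exc_le (x z a : Euc n) : exc x z a ≤ ⟪a, x⟫ ^ 2 := by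
  unfold exc; split_ifs
  · positivity
  · exact le_rfl

lemma sgn_mul {p t : ℝ} (hp : 0 < p) : sgn (p * t) = sgn t := by
  unfold sgn
  simp only [mul_nonneg_iff_of_pos_left hp]

lemma exc_integral_le [IsProbabilityMeasure (sphereUniform n)] (hn : 0 < n)
    {e1 e2 x z : Euc n} (h1 : ⟪e1, e1⟫ = 1) (h2 : ⟪e2, e2⟫ = 1) (h12 : ⟪e1, e2⟫ = 0)
    {p q θ : ℝ} (hp : 0 < p) (hq : 0 < q) (h0 : 0 ≤ θ) (hθ : θ < Real.pi / 2)
    (hx : x = p • e1) (hz : z = q • (Real.cos θ • e1 + Real.sin θ • e2)) :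
    ∫ a, exc x z a ∂(sphereUniform n) ≤
      p ^ 2 * (θ - Real.sin θ * Real.cos θ) / (Real.pi * n) := by
  have hpi := Real.pi_pos
  have h21 : ⟪e2, e1⟫ = 0 := by rw [real_inner_comm]; exact h12
  have hr1 : ∀ φ a, ⟪rotFun e1 e2 φ a, e1⟫ = Real.cos φ * ⟪a, e1⟫ - Real.sin φ * ⟪a, e2⟫ := by
    intro φ a
    simp only [rotFun, inner_add_left, inner_smul_left, h1, h21, conj_trivial]
    ring
  have hr2 : ∀ φ a, ⟪rotFun e1 e2 φ a, e2⟫ = Real.cos φ * ⟪a, e2⟫ + Real.sin φ * ⟪a, e1⟫ := by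
    intro φ a
    simp only [rotFun, inner_add_left, inner_smul_left, h2, h12, conj_trivial]
    ring
  have step1 : ∀ φ : ℝ, ∫ a, exc x z (rotFun e1 e2 φ a) ∂(sphereUniform n) =
      ∫ a, exc x z a ∂(sphereUniform n) := by
    intro φ
    obtain ⟨L, hL⟩ := rot_iso h1 h2 h12 φ
    simp_rw [← hL]
    exact integral_comp_iso L _
  have step2 : ∫ φ in (0:ℝ)..(2 * Real.pi), ∫ a, exc x z (rotFun e1 e2 φ a) ∂(sphereUniform n) =
      2 * Real.pi * ∫ a, exc x z a ∂(sphereUniform n) := by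
    simp_rw [step1]
    simp
  have hcont : Continuous (fun u : ℝ × Euc n => rotFun e1 e2 u.1 u.2) := by
    unfold rotFun; fun_prop
  have step3 : ∫ φ in (0:ℝ)..(2 * Real.pi), ∫ a, exc x z (rotFun e1 e2 φ a) ∂(sphereUniform n) =
      ∫ a, (∫ φ in (0:ℝ)..(2 * Real.pi), exc x z (rotFun e1 e2 φ a)) ∂(sphereUniform n) := by
    refine intervalIntegral_integral_swap ?_
    have hi : Integrable (fun a : Euc n => ‖x‖ ^ 2 * ‖a‖ ^ 2) (sphereUniform n) := by
      refine Integrable.of_bound (C := ‖x‖ ^ 2)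
        (by fun_prop : Continuous fun a : Euc n => ‖x‖ ^ 2 * ‖a‖ ^ 2).aestronglyMeasurable ?_
      filter_upwards [ae_norm n] with a ha
      simp [ha]
    have : IsFiniteMeasure ((volume : Measure ℝ).restrict (Set.uIoc 0 (2 * Real.pi))) := by
      unfold Set.uIoc; infer_instance
    refine (hi.comp_snd (volume.restrict (Set.uIoc 0 (2 * Real.pi)))).mono'
      ((measurable_exc x z).comp hcont.measurable).aestronglyMeasurable ?_
    refine Filter.Eventually.of_forall fun u => ?_
    simp only [Function.uncurry]
    rw [Real.norm_of_nonneg (exc_nonneg _ _ _)]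
    obtain ⟨L, hL⟩ := rot_iso h1 h2 h12 u.1
    have hn1 : ‖rotFun e1 e2 u.1 u.2‖ = ‖u.2‖ := by rw [← hL, L.norm_map]
    refine (exc_le _ _ _).trans ?_
    rw [← sq_abs, ← mul_pow]
    have := abs_real_inner_le_norm (rotFun e1 e2 u.1 u.2) x
    rw [hn1] at this
    have h3 : |⟪rotFun e1 e2 u.1 u.2, x⟫| ≤ ‖x‖ * ‖u.2‖ := by linarith
    gcongr
  have step4 : ∀ a : Euc n, ∫ φ in (0:ℝ)..(2 * Real.pi), exc x z (rotFun e1 e2 φ a) ≤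
      p ^ 2 * (θ - Real.sin θ * Real.cos θ) * (⟪a, e1⟫ ^ 2 + ⟪a, e2⟫ ^ 2) := by
    intro a
    set w : ℂ := ⟨⟪a, e1⟫, ⟪a, e2⟫⟩ with hw
    have w1 : ⟪a, e1⟫ = ‖w‖ * Real.cos w.arg := (Complex.norm_mul_cos_arg w).symm
    have w2 : ⟪a, e2⟫ = ‖w‖ * Real.sin w.arg := (Complex.norm_mul_sin_arg w).symm
    have hr := norm_nonneg w
    generalize ‖w‖ = r at w1 w2 hr
    generalize w.arg = α at w1 w2
    have hpt : ∀ φ, exc x z (rotFun e1 e2 φ a) = p ^ 2 * r ^ 2 * prof θ (φ + α) := by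
      intro φ
      have i1 : ⟪rotFun e1 e2 φ a, x⟫ = p * (r * Real.cos (φ + α)) := by
        rw [hx, inner_smul_right, hr1, w1, w2, Real.cos_add]; ring
      have i2 : ⟪rotFun e1 e2 φ a, z⟫ = q * (r * Real.cos (φ + α - θ)) := by
        rw [hz, inner_smul_right, inner_add_right, inner_smul_right, inner_smul_right,
          hr1, hr2, w1, w2, Real.cos_sub, Real.cos_add, Real.sin_add]; ring
      unfold exc prof
      rw [i1, i2]
      rcases hr.eq_or_lt with hr | hr
      · simp [← hr]
      · rw [sgn_mul hp, sgn_mul hq, sgn_mul hr, sgn_mul hr]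
        split_ifs <;> ring
    simp_rw [hpt]
    rw [intervalIntegral.integral_const_mul, intervalIntegral.integral_comp_add_right (prof θ) α]
    have hb := prof_integral_le h0 hθ α
    have : (0:ℝ) + α = α := by ring
    rw [this, add_comm (2 * Real.pi) α]
    have hsq : ⟪a, e1⟫ ^ 2 + ⟪a, e2⟫ ^ 2 = r ^ 2 := by
      rw [w1, w2]; nlinarith [Real.sin_sq_add_cos_sq α]
    rw [hsq]
    have : p ^ 2 * r ^ 2 * (∫ φ in α..(α + 2 * Real.pi), prof θ φ) ≤
      p ^ 2 * r ^ 2 * (θ - Real.sin θ * Real.cos θ) := by gcongr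
    linarith
  have step5 : ∫ a, (∫ φ in (0:ℝ)..(2 * Real.pi), exc x z (rotFun e1 e2 φ a)) ∂(sphereUniform n) ≤
      ∫ a, p ^ 2 * (θ - Real.sin θ * Real.cos θ) * (⟪a, e1⟫ ^ 2 + ⟪a, e2⟫ ^ 2)
        ∂(sphereUniform n) := by
    refine integral_mono_of_nonneg ?_ (((int_sq e1).add (int_sq e2)).const_mul _) ?_
    · exact Filter.Eventually.of_forall fun a =>
        intervalIntegral.integral_nonneg (by positivity) fun φ _ => exc_nonneg _ _ _
    · exact Filter.Eventually.of_forall step4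
  rw [integral_const_mul, integral_add (int_sq e1) (int_sq e2), integral_sq hn, integral_sq hn,
    ← real_inner_self_eq_norm_sq, ← real_inner_self_eq_norm_sq, h1, h2, ← step3, step2] at step5
  have hn' : (0:ℝ) < n := by exact_mod_cast hn
  rw [le_div_iff₀ (by positivity)]
  have h6 : p ^ 2 * (θ - Real.sin θ * Real.cos θ) * (1 / (n:ℝ) + 1 / n) * n =
      2 * (p ^ 2 * (θ - Real.sin θ * Real.cos θ)) := by field_simp; ring
  have h7 := mul_le_mul_of_nonneg_right step5 hn'.le
  rw [h6] at h7
  linarith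

lemma step_eq (x z a : Euc n) (ha : ‖a‖ = 1) :
    ‖kacStep x a z - x‖ ^ 2 = ‖z - x‖ ^ 2 - ⟪a, z - x⟫ ^ 2 + 4 * exc x z a := by
  have e : kacStep x a z - x = (z - x) + (sgn ⟪a, z⟫ * |⟪a, x⟫| - ⟪a, z⟫) • a := by
    unfold kacStep; abel
  rw [e, norm_add_sq_real, norm_smul, ha, inner_smul_right, real_inner_comm a (z - x),
    inner_sub_right, mul_one, Real.norm_eq_abs, sq_abs]
  unfold exc sgn
  rcases le_or_gt 0 ⟪a, x⟫ with h | h <;> rcases le_or_gt 0 ⟪a, z⟫ with h' | h'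
  · simp [h, h', abs_of_nonneg h]; ring
  · have : ¬ ((1:ℝ) = -1) := by norm_num
    simp [h, h'.not_ge, abs_of_nonneg h, this]; ring
  · have : ¬ ((-1:ℝ) = 1) := by norm_num
    simp [h.not_ge, h', abs_of_neg h, this]; ring
  · simp [h.not_ge, h'.not_ge, abs_of_neg h]; ring

lemma exists_frame (hn : 2 ≤ n) (x z : Euc n) (hxz : 0 < ⟪z, x⟫) :
    ∃ e1 e2 : Euc n, ⟪e1, e1⟫ = 1 ∧ ⟪e2, e2⟫ = 1 ∧ ⟪e1, e2⟫ = 0 ∧ x = ‖x‖ • e1 ∧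
      z = ‖z‖ • (Real.cos (InnerProductGeometry.angle z x) • e1 +
        Real.sin (InnerProductGeometry.angle z x) • e2) := by
  have hx : x ≠ 0 := by rintro rfl; simp at hxz
  have hz : z ≠ 0 := by rintro rfl; simp at hxz
  have hx' : 0 < ‖x‖ := norm_pos_iff.2 hx
  have hz' : 0 < ‖z‖ := norm_pos_iff.2 hz
  set e1 : Euc n := ‖x‖⁻¹ • x with he1
  have hxe : x = ‖x‖ • e1 := by rw [he1, smul_smul, mul_inv_cancel₀ hx'.ne', one_smul]
  have h1 : ⟪e1, e1⟫ = 1 := by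
    rw [he1, inner_smul_left, inner_smul_right, real_inner_self_eq_norm_sq]
    simp; field_simp
  set w : Euc n := z - ⟪e1, z⟫ • e1 with hw
  have hw1 : ⟪e1, w⟫ = 0 := by rw [hw, inner_sub_right, inner_smul_right, h1]; ring
  obtain ⟨e2, h2, h12, hwe⟩ : ∃ e2 : Euc n, ⟪e2, e2⟫ = 1 ∧ ⟪e1, e2⟫ = 0 ∧ w = ‖w‖ • e2 := by
    have mk : ∀ u : Euc n, u ≠ 0 → ⟪e1, u⟫ = 0 → ∃ e2 : Euc n, ⟪e2, e2⟫ = 1 ∧ ⟪e1, e2⟫ = 0 ∧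
        u = ‖u‖ • e2 := by
      intro u hu hu1
      have hu' : 0 < ‖u‖ := norm_pos_iff.2 hu
      refine ⟨‖u‖⁻¹ • u, ?_, ?_, ?_⟩
      · rw [inner_smul_left, inner_smul_right, real_inner_self_eq_norm_sq]
        simp; field_simp
      · rw [inner_smul_right, hu1, mul_zero]
      · rw [smul_smul, mul_inv_cancel₀ hu'.ne', one_smul]
    by_cases hw0 : w = 0
    · have : ∃ u : Euc n, u ≠ 0 ∧ ⟪e1, u⟫ = 0 := by
        have hne : (ℝ ∙ e1)ᗮ ≠ ⊥ := by
          intro hbot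
          have hf := Submodule.finrank_add_finrank_orthogonal (ℝ ∙ e1)
          rw [hbot, finrank_bot, finrank_euclideanSpace_fin] at hf
          have := finrank_span_le_card (R := ℝ) ({e1} : Set (Euc n))
          simp at this
          omega
        obtain ⟨u, hu, hu0⟩ := Submodule.exists_mem_ne_zero_of_ne_bot hne
        exact ⟨u, hu0, Submodule.mem_orthogonal_singleton_iff_inner_right.1 hu⟩
      obtain ⟨u, hu0, hu⟩ := this
      obtain ⟨e2, a, b, _⟩ := mk u hu0 hu
      exact ⟨e2, a, b, by rw [hw0]; simp⟩
    · exact mk w hw0 hw1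
  have hzz : z = ⟪e1, z⟫ • e1 + ‖w‖ • e2 := by rw [← hwe, hw]; abel
  have hcos : ‖z‖ * Real.cos (InnerProductGeometry.angle z x) = ⟪e1, z⟫ := by
    rw [InnerProductGeometry.cos_angle, he1, inner_smul_left, real_inner_comm x z]
    simp; field_simp
  have hnz : ‖z‖ ^ 2 = ⟪e1, z⟫ ^ 2 + ‖w‖ ^ 2 := by
    have h21 : ⟪e2, e1⟫ = 0 := by rw [real_inner_comm]; exact h12
    generalize ⟪e1, z⟫ = c at *
    generalize ‖w‖ = s at *
    rw [← real_inner_self_eq_norm_sq, hzz]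
    simp only [inner_add_left, inner_add_right, inner_smul_left, inner_smul_right, h1, h2, h12, h21,
      conj_trivial]
    ring
  have hsin : ‖z‖ * Real.sin (InnerProductGeometry.angle z x) = ‖w‖ := by
    have hs := InnerProductGeometry.sin_angle_nonneg z x
    refine (sq_eq_sq₀ (by positivity) (norm_nonneg _)).1 ?_
    have := Real.sin_sq_add_cos_sq (InnerProductGeometry.angle z x)
    rw [← hcos] at hnz
    linear_combination hnz + ‖z‖ ^ 2 * this
  refine ⟨e1, e2, h1, h2, h12, hxe, ?_⟩
  rw [smul_add, smul_smul ‖z‖ _ e1, smul_smul ‖z‖ _ e2, hcos, hsin]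
  exact hzz

end KacAux

/-- **Lemma (Expected decrement for the uniform measure).** For `x, z ∈ ℝⁿ` (`n ≥ 3`)
with `⟨z,x⟩ > 0` and `θ` the angle between them, the generalized Kaczmarz projection
`P = P_σ` with respect to the uniform measure `σ` on `S^{n−1}` satisfies
`E‖Pz − x‖² ≤ [1 − (1 − 4(θ + sin θ)/π)/n] ‖z − x‖²`. -/
theorem expected_decrement_uniform {n : ℕ} (hn : 3 ≤ n) (x z : Euc n)
    (hxz : 0 < ⟪z, x⟫) :
    ∫ a, ‖kacStep x a z - x‖ ^ 2 ∂(sphereUniform n) ≤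
      (1 - (1 - 4 * (InnerProductGeometry.angle z x +
          Real.sin (InnerProductGeometry.angle z x)) / Real.pi) / n) * ‖z - x‖ ^ 2 := by
  have hpi := Real.pi_pos
  have hn' : (0:ℝ) < n := by exact_mod_cast (by omega : 0 < n)
  have hx : x ≠ 0 := by rintro rfl; simp at hxz
  have hz : z ≠ 0 := by rintro rfl; simp at hxz
  obtain ⟨e1, e2, h1, h2, h12, hxe, hze⟩ := KacAux.exists_frame (by omega) x z hxz
  have h0 := InnerProductGeometry.angle_nonneg z x
  have hθ : InnerProductGeometry.angle z x < Real.pi / 2 :=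
    Real.arccos_lt_pi_div_two.2
      (div_pos hxz (mul_pos (norm_pos_iff.2 hz) (norm_pos_iff.2 hx)))
  have hs := InnerProductGeometry.sin_angle_nonneg z x
  have hcos := InnerProductGeometry.cos_angle_mul_norm_mul_norm z x
  generalize InnerProductGeometry.angle z x = θ at *
  rcases KacAux.prob_or_zero n with hP | hP
  · have hE := KacAux.exc_integral_le (by omega) h1 h2 h12 (norm_pos_iff.2 hx) (norm_pos_iff.2 hz)
      h0 hθ hxe hze
    have hI : Integrable (KacAux.exc x z) (sphereUniform n) := by
      refine (KacAux.int_sq x).mono' (KacAux.measurable_exc x z).aestronglyMeasurable ?_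
      refine Filter.Eventually.of_forall fun a => ?_
      rw [Real.norm_of_nonneg (KacAux.exc_nonneg _ _ _)]
      exact KacAux.exc_le _ _ _
    have hc : ∀ᵐ a ∂(sphereUniform n), ‖kacStep x a z - x‖ ^ 2 =
        ‖z - x‖ ^ 2 - ⟪a, z - x⟫ ^ 2 + 4 * KacAux.exc x z a := by
      filter_upwards [KacAux.ae_norm n] with a ha
      exact KacAux.step_eq x z a ha
    have hI2 : Integrable (fun a => ‖z - x‖ ^ 2 - ⟪a, z - x⟫ ^ 2) (sphereUniform n) :=
      (integrable_const _).sub (KacAux.int_sq _)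
    rw [integral_congr_ae hc, integral_add hI2 (hI.const_mul 4),
      integral_sub (integrable_const _) (KacAux.int_sq _), integral_const_mul,
      KacAux.integral_sq (by omega)]
    simp only [integral_const, probReal_univ, one_smul]
    have hd : ‖x‖ ^ 2 * Real.sin θ ^ 2 ≤ ‖z - x‖ ^ 2 := by
      rw [norm_sub_sq_real, ← hcos]
      have := Real.sin_sq_add_cos_sq θ
      nlinarith [sq_nonneg (‖z‖ - ‖x‖ * Real.cos θ)]
    have ha := KacAux.angle_ineq h0 hθ
    have hb : ‖x‖ ^ 2 * (θ - Real.sin θ * Real.cos θ) ≤ (θ + Real.sin θ) * ‖z - x‖ ^ 2 := by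
      calc _ ≤ ‖x‖ ^ 2 * ((θ + Real.sin θ) * Real.sin θ ^ 2) := by gcongr
        _ = (θ + Real.sin θ) * (‖x‖ ^ 2 * Real.sin θ ^ 2) := by ring
        _ ≤ _ := by gcongr
    have hE2 : ∫ a, KacAux.exc x z a ∂(sphereUniform n) ≤
        (θ + Real.sin θ) * ‖z - x‖ ^ 2 / (Real.pi * n) := hE.trans (by gcongr)
    have : (1 - (1 - 4 * (θ + Real.sin θ) / Real.pi) / n) * ‖z - x‖ ^ 2 =
      ‖z - x‖ ^ 2 - ‖z - x‖ ^ 2 / n + 4 * ((θ + Real.sin θ) * ‖z - x‖ ^ 2 / (Real.pi * n)) := by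
      field_simp; ring
    rw [this]
    linarith
  · rw [hP, integral_zero_measure]
    refine mul_nonneg ?_ (by positivity)
    have h1n : (1:ℝ) ≤ n := by exact_mod_cast (by omega : 1 ≤ n)
    have hq : 0 ≤ 4 * (θ + Real.sin θ) / Real.pi := by positivity
    rw [sub_nonneg, div_le_one hn']
    linarith
end
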